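/- arXiv:2201.12587 — 9 statements merged into one kernel-verified Lean document; each statement's English description precedes it below -/
import Mathlib

section
/- Suppose vectors φ0, φ1, μ, b in H and real numbers r0, rt, r1 and γ ∈ [0,1] satisfy: (i) φ1 − φ0 = −δt·(G μ); (ii) μ = L φ1 + rt·b; (iii) rt − r0 = (1/2)·⟪b, φ1 − φ0⟫; (iv) r1² − rt² ≤ δt·γ·⟪G μ, μ⟫. Then (1/2)·⟪L φ1, φ1⟫ + r1² − ((1/2)·⟪L φ0, φ0⟫ + r0²) ≤ −δt·(1−γ)·⟪G μ, μ⟫. (Unconditional energy stability of the relaxed SAV/BDF1 scheme.) -/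
open RealInnerProductSpace

/-- Unconditional energy stability of the relaxed SAV/BDF1 scheme. -/
theorem relaxed_SAV_BDF1_energy_stable
    {H : Type*} [NormedAddCommGroup H] [InnerProductSpace ℝ H]
    (L G : H →L[ℝ] H)
    (hLsym : ∀ x y : H, ⟪L x, y⟫ = ⟪x, L y⟫)
    (hLpos : ∀ x : H, 0 ≤ ⟪L x, x⟫)
    (hGpos : ∀ x : H, 0 ≤ ⟪G x, x⟫)
    (δt : ℝ) (hδt : 0 < δt)
    (φ0 φ1 μ b : H) (r0 rt r1 γ : ℝ)
    (hγ0 : 0 ≤ γ) (hγ1 : γ ≤ 1)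
    (h1 : φ1 - φ0 = -(δt • G μ))
    (h2 : μ = L φ1 + rt • b)
    (h3 : rt - r0 = (1/2) * ⟪b, φ1 - φ0⟫)
    (h4 : r1 ^ 2 - rt ^ 2 ≤ δt * γ * ⟪G μ, μ⟫) :
    (1/2) * ⟪L φ1, φ1⟫ + r1 ^ 2 - ((1/2) * ⟪L φ0, φ0⟫ + r0 ^ 2)
      ≤ -(δt * (1 - γ) * ⟪G μ, μ⟫) := by
  have e1 : ⟪μ, φ1 - φ0⟫ = -(δt * ⟪G μ, μ⟫) := by
    rw [h1, inner_neg_right, real_inner_smul_right, real_inner_comm]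
  have e2 : ⟪μ, φ1 - φ0⟫ = ⟪L φ1, φ1 - φ0⟫ + rt * ⟪b, φ1 - φ0⟫ := by
    conv_lhs => rw [h2]
    rw [inner_add_left, real_inner_smul_left]
  have e3 : ⟪L (φ1 - φ0), φ1 - φ0⟫
      = 2 * ⟪L φ1, φ1 - φ0⟫ - ⟪L φ1, φ1⟫ + ⟪L φ0, φ0⟫ := by
    have hs : ⟪L φ0, φ1⟫ = ⟪L φ1, φ0⟫ := by
      rw [hLsym, real_inner_comm]
    simp only [map_sub, inner_sub_left, inner_sub_right]
    linarith
  have e4 := hLpos (φ1 - φ0)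
  have e5 : ⟪b, φ1 - φ0⟫ = 2 * (rt - r0) := by linarith
  rw [e5] at e2
  nlinarith [sq_nonneg (rt - r0)]
end

section
/- Suppose vectors φ0, φ1, φ2, μ, b in H and real numbers r0, r1, rt, r2 and γ ∈ [0,1] satisfy: (i) (3/2)·φ2 − 2·φ1 + (1/2)·φ0 = −δt·(G μ); (ii) μ = L φ2 + rt·b; (iii) (3/2)·rt − 2·r1 + (1/2)·r0 = (1/2)·⟪b, (3/2)·φ2 − 2·φ1 + (1/2)·φ0⟫; (iv) (1/2)·(r2² + (2·r2 − r1)² − rt² − (2·rt − r1)²) ≤ δt·γ·⟪G μ, μ⟫. Define R_new = (1/4)·(⟪L φ2, φ2⟫ + ⟪L (2·φ2 − φ1), 2·φ2 − φ1⟫) + (1/2)·(r2² + (2·r2 − r1)²) and R_old = (1/4)·(⟪L φ1, φ1⟫ + ⟪L (2·φ1 − φ0), 2·φ1 − φ0⟫) + (1/2)·(r1² + (2·r1 − r0)²). Then R_new − R_old ≤ −δt·(1−γ)·⟪G μ, μ⟫. (Unconditional energy stability of the relaxed SAV/BDF2 scheme.) -/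
open RealInnerProductSpace

/-- Unconditional energy stability of the relaxed SAV/BDF2 scheme. -/
theorem relaxed_SAV_BDF2_energy_stable
    {H : Type*} [NormedAddCommGroup H] [InnerProductSpace ℝ H]
    (L G : H →L[ℝ] H)
    (hLsym : ∀ x y : H, ⟪L x, y⟫ = ⟪x, L y⟫)
    (hLpos : ∀ x : H, 0 ≤ ⟪L x, x⟫)
    (hGpos : ∀ x : H, 0 ≤ ⟪G x, x⟫)
    (δt : ℝ) (hδt : 0 < δt)
    (φ0 φ1 φ2 μ b : H) (r0 r1 rt r2 γ : ℝ)
    (hγ0 : 0 ≤ γ) (hγ1 : γ ≤ 1)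
    (h1 : (3/2 : ℝ) • φ2 - (2 : ℝ) • φ1 + (1/2 : ℝ) • φ0 = -(δt • G μ))
    (h2 : μ = L φ2 + rt • b)
    (h3 : (3/2) * rt - 2 * r1 + (1/2) * r0
        = (1/2) * ⟪b, (3/2 : ℝ) • φ2 - (2 : ℝ) • φ1 + (1/2 : ℝ) • φ0⟫)
    (h4 : (1/2) * (r2 ^ 2 + (2 * r2 - r1) ^ 2 - rt ^ 2 - (2 * rt - r1) ^ 2)
        ≤ δt * γ * ⟪G μ, μ⟫) :
    ((1/4) * (⟪L φ2, φ2⟫ + ⟪L ((2 : ℝ) • φ2 - φ1), (2 : ℝ) • φ2 - φ1⟫)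
        + (1/2) * (r2 ^ 2 + (2 * r2 - r1) ^ 2))
      - ((1/4) * (⟪L φ1, φ1⟫ + ⟪L ((2 : ℝ) • φ1 - φ0), (2 : ℝ) • φ1 - φ0⟫)
        + (1/2) * (r1 ^ 2 + (2 * r1 - r0) ^ 2))
      ≤ -(δt * (1 - γ) * ⟪G μ, μ⟫) := by
  have e1 : ⟪L φ2, (3/2 : ℝ) • φ2 - (2 : ℝ) • φ1 + (1/2 : ℝ) • φ0⟫
      + rt * ⟪b, (3/2 : ℝ) • φ2 - (2 : ℝ) • φ1 + (1/2 : ℝ) • φ0⟫ = -(δt * ⟪G μ, μ⟫) := by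
    have : ⟪μ, (3/2 : ℝ) • φ2 - (2 : ℝ) • φ1 + (1/2 : ℝ) • φ0⟫ = -(δt * ⟪G μ, μ⟫) := by
      rw [h1, inner_neg_right, real_inner_smul_right, real_inner_comm]
    rw [← this]
    conv_rhs => rw [h2]
    rw [inner_add_left, real_inner_smul_left]
  have hp := hLpos (φ2 - (2 : ℝ) • φ1 + φ0)
  have s10 : ⟪L φ1, φ0⟫ = ⟪L φ0, φ1⟫ := by rw [hLsym, real_inner_comm]
  have s20 : ⟪L φ2, φ0⟫ = ⟪L φ0, φ2⟫ := by rw [hLsym, real_inner_comm]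
  have s21 : ⟪L φ2, φ1⟫ = ⟪L φ1, φ2⟫ := by rw [hLsym, real_inner_comm]
  have e2 : rt * ⟪b, (3/2 : ℝ) • φ2 - (2 : ℝ) • φ1 + (1/2 : ℝ) • φ0⟫
      = 2 * rt * ((3/2) * rt - 2 * r1 + (1/2) * r0) := by
    rw [h3]; ring
  rw [e2] at e1
  simp only [map_add, map_sub, map_smul, inner_add_left, inner_add_right, inner_sub_left,
    inner_sub_right, real_inner_smul_left, real_inner_smul_right, s10, s20, s21] at e1 hp ⊢
  nlinarith [sq_nonneg (rt - 2 * r1 + r0)]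
end

section
/- Let δt > 0, Rt ≥ 0, Eφ > 0, Eb > 0, Kφ > 0, Kb > 0 be real numbers with Rt < Eφ and Rt − Eφ + δt·Rt·Kb/Eb < 0. Set ζ₀ = 1 − δt·Rt·Kb/(Eb·(Eφ − Rt)) and γ = 0. Then ζ₀ ∈ [0,1], the relaxation condition (Rt − Eφ)·ζ₀ ≤ Rt − Eφ − δt·γ·Kφ + δt·Rt·Kb/Eb holds (with equality), and R := ζ₀·Rt + (1 − ζ₀)·Eφ satisfies Rt ≤ R ≤ Eφ. (Validity of the choice of ζ₀ and γ^{n+1} in Case 4 of Theorem 3.1.) -/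
/-- Validity of the choice of ζ₀ and γ^{n+1} in Case 4 of Theorem 3.1. -/
theorem RGSAV_case4_choice_valid
    (δt Rt Eφ Eb Kφ Kb : ℝ)
    (hδt : 0 < δt) (hRt : 0 ≤ Rt) (hEφ : 0 < Eφ) (hEb : 0 < Eb)
    (hKφ : 0 < Kφ) (hKb : 0 < Kb)
    (hlt : Rt < Eφ)
    (hcase : Rt - Eφ + δt * Rt * Kb / Eb < 0) :
    (0 ≤ 1 - δt * Rt * Kb / (Eb * (Eφ - Rt)) ∧ 1 - δt * Rt * Kb / (Eb * (Eφ - Rt)) ≤ 1) ∧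
    (Rt - Eφ) * (1 - δt * Rt * Kb / (Eb * (Eφ - Rt)))
      ≤ Rt - Eφ - δt * (0 : ℝ) * Kφ + δt * Rt * Kb / Eb ∧
    (Rt - Eφ) * (1 - δt * Rt * Kb / (Eb * (Eφ - Rt)))
      = Rt - Eφ - δt * (0 : ℝ) * Kφ + δt * Rt * Kb / Eb ∧
    Rt ≤ (1 - δt * Rt * Kb / (Eb * (Eφ - Rt))) * Rt
          + (1 - (1 - δt * Rt * Kb / (Eb * (Eφ - Rt)))) * Eφ ∧
    (1 - δt * Rt * Kb / (Eb * (Eφ - Rt))) * Rt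
          + (1 - (1 - δt * Rt * Kb / (Eb * (Eφ - Rt)))) * Eφ ≤ Eφ := by
  have hd : 0 < Eφ - Rt := sub_pos.mpr hlt
  have hx0 : 0 ≤ δt * Rt * Kb / (Eb * (Eφ - Rt)) := by positivity
  have hmul : δt * Rt * Kb / (Eb * (Eφ - Rt)) * (Eφ - Rt) = δt * Rt * Kb / Eb := by
    rw [← div_div]
    exact div_mul_cancel₀ _ hd.ne'
  have hx1 : δt * Rt * Kb / (Eb * (Eφ - Rt)) ≤ 1 := by
    rw [← div_div, div_le_one hd]
    linarith
  generalize δt * Rt * Kb / (Eb * (Eφ - Rt)) = x at *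
  have heq : (Rt - Eφ) * (1 - x) = Rt - Eφ - δt * (0 : ℝ) * Kφ + δt * Rt * Kb / Eb := by
    rw [← hmul]
    ring
  refine ⟨⟨by linarith, by linarith⟩, heq.le, heq, ?_, ?_⟩
  · nlinarith [mul_nonneg hx0 hd.le]
  · nlinarith [mul_nonneg (sub_nonneg.mpr hx1) hd.le]
end

section
/- Let H be a real inner product space and L a continuous linear operator on H with ⟪L x, x⟫ ≥ 0 for all x ∈ H. For every natural number k and every real M > 0 there exists a real M_k > 0 such that: for every φb ∈ H, every real e > 1, and every real Rt with 0 ≤ Rt ≤ M, setting ξ = Rt/(⟪L φb, φb⟫ + e), η = 1 − (1 − ξ)^{k+1}, and φ = η·φb, one has ⟪L φ, φ⟫ ≤ M_k². (Uniform bound (3.12) of Theorem 3.1 on the numerical solution.) -/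
open RealInnerProductSpace

/-- Uniform bound (3.12) of Theorem 3.1 on the numerical solution. -/
theorem RGSAV_uniform_solution_bound
    {H : Type*} [NormedAddCommGroup H] [InnerProductSpace ℝ H]
    (L : H →L[ℝ] H) (hLpos : ∀ x : H, 0 ≤ ⟪L x, x⟫)
    (k : ℕ) (M : ℝ) (hM : 0 < M) :
    ∃ Mk : ℝ, 0 < Mk ∧
      ∀ (φb : H) (e Rt : ℝ), 1 < e → 0 ≤ Rt → Rt ≤ M →
        ⟪L (((1 - (1 - Rt / (⟪L φb, φb⟫ + e)) ^ (k + 1)) : ℝ) • φb),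
            ((1 - (1 - Rt / (⟪L φb, φb⟫ + e)) ^ (k + 1)) : ℝ) • φb⟫ ≤ Mk ^ 2 := by
  have hC : 0 < ∑ i ∈ Finset.range (k + 1), (1 + M) ^ i :=
    Finset.sum_pos (fun i _ => by positivity) ⟨0, by simp⟩
  refine ⟨(∑ i ∈ Finset.range (k + 1), (1 + M) ^ i) * M, by positivity, ?_⟩
  intro φb e Rt he hR0 hRM
  rw [map_smul, real_inner_smul_left, real_inner_smul_right]
  have ha := hLpos φb
  generalize ⟪L φb, φb⟫ = a at ha ⊢
  generalize hCd : ∑ i ∈ Finset.range (k + 1), (1 + M) ^ i = C at hC ⊢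
  have hd : 0 < a + e := by linarith
  have hx0 : 0 ≤ Rt / (a + e) := by positivity
  have hxd : Rt / (a + e) * (a + e) = Rt := by field_simp
  generalize Rt / (a + e) = x at hx0 hxd ⊢
  have hxM : x ≤ M := by nlinarith
  have hS : |∑ i ∈ Finset.range (k + 1), (1 - x) ^ i| ≤ C := by
    rw [← hCd]
    refine (Finset.abs_sum_le_sum_abs _ _).trans (Finset.sum_le_sum fun i _ => ?_)
    rw [abs_pow]
    exact pow_le_pow_left₀ (abs_nonneg _) (abs_le.2 ⟨by linarith, by linarith⟩) i
  have hg := mul_neg_geom_sum (1 - x) (k + 1)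
  rw [← hg]
  generalize ∑ i ∈ Finset.range (k + 1), (1 - x) ^ i = S at hS ⊢
  have hS2 : S ^ 2 ≤ C ^ 2 := sq_le_sq' (abs_le.1 hS).1 (abs_le.1 hS).2
  have hxa : x * a ≤ M := by nlinarith
  have hxxa : x * (x * a) ≤ M * M := mul_le_mul hxM hxa (by positivity) hM.le
  have := mul_le_mul hS2 hxxa (by positivity) (by positivity)
  calc _ = S ^ 2 * (x * (x * a)) := by ring
    _ ≤ _ := this
    _ = _ := by ring
end

section
/- There exist a real number τ with 0 ≤ τ < 1, a symmetric positive definite real 3×3 matrix G = (g_{ij})_{1≤i,j≤3}, and real numbers a₀, a₁, a₂, a₃, such that for every real inner product space H and all φ₀, φ₁, φ₂, φ₃ ∈ H: ⟪(11/6)·φ₃ − 3·φ₂ + (3/2)·φ₁ − (1/3)·φ₀, φ₃ − τ·φ₂⟫ = Σ_{i,j=1}^{3} g_{ij}·⟪φ_i, φ_j⟫ − Σ_{i,j=1}^{3} g_{ij}·⟪φ_{i−1}, φ_{j−1}⟫ + ‖a₀·φ₀ + a₁·φ₁ + a₂·φ₂ + a₃·φ₃‖². (Lemma 4.1, Nevanlinna–Odeh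 multiplier identity, case k = 3.) -/
open RealInnerProductSpace

universe u

lemma bdf3_form_pos (m : ℝ) (hm : m ^ 2 = 33) (h1 : 5.74 < m) (h2 : m < 5.75) (x y z : ℝ)
    (h : (202 - 26 * m) * x ^ 2 + (964 - 80 * m) * y ^ 2 + (1294 - 26 * m) * z ^ 2
      + 2 * (40 * m - 384) * (x * y) + 2 * (294 - 14 * m) * (x * z)
      + 2 * (40 * m - 972) * (y * z) ≤ 0) : x = 0 ∧ y = 0 ∧ z = 0 := by
  obtain ⟨A, hA⟩ : ∃ A, A = 202 - 26 * m := ⟨_, rfl⟩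
  obtain ⟨B, hB⟩ : ∃ B, B = (638 * m - 5646) / 17 := ⟨_, rfl⟩
  obtain ⟨C, hC⟩ : ∃ C, C = (191098 - 19274 * m) / 289 := ⟨_, rfl⟩
  have hApos : 0 < A := by rw [hA]; linarith
  have hD : 0 < A * C - B ^ 2 := by
    have : A * C - B ^ 2 = ((202 - 26 * m) * (191098 - 19274 * m) - (638 * m - 5646) ^ 2) / 289 := by
      rw [hA, hB, hC]; ring
    rw [this]
    apply div_pos _ (by norm_num)
    nlinarith
  have key : ((m - 13) * x + (27 - m) * y + (-420 - 14 * m) / 17 * z) ^ 2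
      + (A * y ^ 2 + 2 * B * (y * z) + C * z ^ 2) ≤ 0 := by
    refine le_trans (le_of_eq ?_) h
    rw [hA, hB, hC]
    linear_combination (x ^ 2 + y ^ 2 + 196 / 289 * z ^ 2 - 2 * (x * y) - 28 / 17 * (x * z) + 28 / 17 * (y * z)) * hm
  have hQ : A * (A * y ^ 2 + 2 * B * (y * z) + C * z ^ 2)
      = (A * y + B * z) ^ 2 + (A * C - B ^ 2) * z ^ 2 := by ring
  have hQ0 : A * y ^ 2 + 2 * B * (y * z) + C * z ^ 2 ≤ 0 := by
    nlinarith [sq_nonneg ((m - 13) * x + (27 - m) * y + (-420 - 14 * m) / 17 * z)]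
  have hz : z = 0 := by
    by_contra hz
    have : 0 < z ^ 2 := by positivity
    have := mul_pos hD this
    have := mul_nonneg hApos.le (neg_nonneg.2 hQ0)
    nlinarith [sq_nonneg (A * y + B * z)]
  subst hz
  have hy : y = 0 := by
    by_contra hy
    have : 0 < y ^ 2 := by positivity
    have := mul_pos hApos this
    nlinarith
  subst hy
  refine ⟨?_, rfl, rfl⟩
  have h0 : ((m - 13) * x) ^ 2 ≤ 0 := by simpa using key
  have h0' : (m - 13) * x = 0 := by
    have := sq_nonneg ((m - 13) * x)
    exact pow_eq_zero_iff (two_ne_zero) |>.1 (le_antisymm h0 this)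
  rcases mul_eq_zero.1 h0' with h | h
  · linarith
  · exact h

/-- Lemma 4.1, Nevanlinna–Odeh multiplier identity, case k = 3. -/
theorem NevanlinnaOdeh_multiplier_BDF3 :
    ∃ (τ : ℝ) (G : Matrix (Fin 3) (Fin 3) ℝ) (a : Fin 4 → ℝ),
      0 ≤ τ ∧ τ < 1 ∧ G.IsSymm ∧ G.PosDef ∧
      ∀ (H : Type u) [NormedAddCommGroup H] [InnerProductSpace ℝ H],
        ∀ φ0 φ1 φ2 φ3 : H,
          ⟪(11/6 : ℝ) • φ3 - (3 : ℝ) • φ2 + (3/2 : ℝ) • φ1 - (1/3 : ℝ) • φ0,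
              φ3 - τ • φ2⟫
            = (∑ i : Fin 3, ∑ j : Fin 3,
                G i j * ⟪![φ0, φ1, φ2, φ3] i.succ, ![φ0, φ1, φ2, φ3] j.succ⟫)
              - (∑ i : Fin 3, ∑ j : Fin 3,
                G i j * ⟪![φ0, φ1, φ2, φ3] i.castSucc, ![φ0, φ1, φ2, φ3] j.castSucc⟫)
              + ‖a 0 • φ0 + a 1 • φ1 + a 2 • φ2 + a 3 • φ3‖ ^ 2 := by
  obtain ⟨m, hm, h1, h2⟩ : ∃ m : ℝ, m ^ 2 = 33 ∧ 5.74 < m ∧ m < 5.75 :=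
    ⟨√33, Real.sq_sqrt (by norm_num), Real.lt_sqrt_of_sq_lt (by norm_num),
      (Real.sqrt_lt' (by norm_num)).2 (by norm_num)⟩
  obtain ⟨c, hc⟩ : ∃ c : ℝ, c ^ 2 = 1 / 816 := ⟨√(1 / 816), Real.sq_sqrt (by norm_num)⟩
  let G : Matrix (Fin 3) (Fin 3) ℝ :=
    !![(202 - 26 * m) / 816, (40 * m - 384) / 816, (294 - 14 * m) / 816;
       (40 * m - 384) / 816, (964 - 80 * m) / 816, (40 * m - 972) / 816;
       (294 - 14 * m) / 816, (40 * m - 972) / 816, (1294 - 26 * m) / 816]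
  have hsymm : G.IsSymm := by
    ext i j
    fin_cases i <;> fin_cases j <;> rfl
  refine ⟨3 / 17, G, ![c * (m - 13), c * (27 - m), c * (-27 - m), c * (13 + m)],
    by norm_num, by norm_num, hsymm, ?_, ?_⟩
  · refine Matrix.PosDef.of_dotProduct_mulVec_pos ?_ ?_
    · rw [Matrix.IsHermitian, Matrix.conjTranspose_eq_transpose_of_trivial]
      exact hsymm
    · intro v hv
      by_contra hneg
      apply hv
      have := bdf3_form_pos m hm h1 h2 (v 0) (v 1) (v 2) (by
        simp [G, Matrix.mulVec, dotProduct, Fin.sum_univ_three] at hneg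
        linarith)
      ext i
      fin_cases i
      · exact this.1
      · exact this.2.1
      · exact this.2.2
  · intro H _ _ φ0 φ1 φ2 φ3
    rw [← real_inner_self_eq_norm_sq]
    have e1 : (Fin.succ 0 : Fin 4) = 1 := rfl
    have e2 : (Fin.succ 1 : Fin 4) = 2 := rfl
    have e3 : (Fin.succ 2 : Fin 4) = 3 := rfl
    have e4 : (Fin.castSucc 0 : Fin 4) = 0 := rfl
    have e5 : (Fin.castSucc 1 : Fin 4) = 1 := rfl
    have e6 : (Fin.castSucc 2 : Fin 4) = 2 := rfl
    simp only [Fin.sum_univ_three, e1, e2, e3, e4, e5, e6, G, Matrix.of_apply,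
      Matrix.cons_val, inner_add_left, inner_add_right, inner_sub_left, inner_sub_right,
      real_inner_smul_left, real_inner_smul_right]
    rw [real_inner_comm φ0 φ1, real_inner_comm φ0 φ2, real_inner_comm φ0 φ3,
      real_inner_comm φ1 φ2, real_inner_comm φ1 φ3, real_inner_comm φ2 φ3]
    generalize ⟪φ0, φ0⟫ = p00
    generalize ⟪φ1, φ1⟫ = p11
    generalize ⟪φ2, φ2⟫ = p22
    generalize ⟪φ3, φ3⟫ = p33
    generalize ⟪φ0, φ1⟫ = p01
    generalize ⟪φ0, φ2⟫ = p02
    generalize ⟪φ0, φ3⟫ = p03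
    generalize ⟪φ1, φ2⟫ = p12
    generalize ⟪φ1, φ3⟫ = p13
    generalize ⟪φ2, φ3⟫ = p23
    linear_combination (-((m-13)^2*p00+(27-m)^2*p11+(-27-m)^2*p22+(13+m)^2*p33
      +2*((m-13)*(27-m)*p01+(m-13)*(-27-m)*p02+(m-13)*(13+m)*p03
      +(27-m)*(-27-m)*p12+(27-m)*(13+m)*p13+(-27-m)*(13+m)*p23))) * hc
      - (1/816) * (p00+p11+p22+p33+2*(-p01-p02+p03+p12-p13-p23)) * hm
end

section
/- There exist a real number τ with 0 ≤ τ < 1, a symmetric positive definite real 4×4 matrix G = (g_{ij})_{1≤i,j≤4}, and real numbers a₀, a₁, a₂, a₃, a₄, such that for every real inner product space H and all φ₀, φ₁, φ₂, φ₃, φ₄ ∈ H: ⟪(25/12)·φ₄ − 4·φ₃ + 3·φ₂ − (4/3)·φ₁ + (1/4)·φ₀, φ₄ − τ·φ₃⟫ = Σ_{i,j=1}^{4} g_{ij}·⟪φ_i, φ_j⟫ − Σ_{i,j=1}^{4} g_{ij}·⟪φ_{i−1}, φ_{j−1}⟫ + ‖a₀·φ₀ + a₁·φ₁ + a₂·φ₂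 + a₃·φ₃ + a₄·φ₄‖². (Lemma 4.1, Nevanlinna–Odeh multiplier identity, case k = 4.) -/
open RealInnerProductSpace

universe u

/-- The spectral factor parameters: a real solution of the autocorrelation equations. -/
theorem exists_params : ∃ u v k K : ℝ, k = K ^ 2 ∧ k * v = 1/24 ∧
    3 * u * (1 + v) = -2 * v ∧ 3 * (1 + u ^ 2 + v ^ 2) = 10 * v ∧
    2.9043 ≤ v ∧ v ≤ 2.9044 := by
  have hc : ContinuousOn (fun v : ℝ => 9*v^4 - 12*v^3 - 38*v^2 - 12*v + 9)
      (Set.Icc 2.9043 2.9044) := by fun_prop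
  have h := intermediate_value_Icc (by norm_num) hc
  have h0 : (0 : ℝ) ∈ Set.Icc ((fun v : ℝ => 9*v^4 - 12*v^3 - 38*v^2 - 12*v + 9) 2.9043)
      ((fun v : ℝ => 9*v^4 - 12*v^3 - 38*v^2 - 12*v + 9) 2.9044) := by
    constructor <;> norm_num
  obtain ⟨v, ⟨hv1, hv2⟩, hv⟩ := h h0
  have hv : 9*v^4 - 12*v^3 - 38*v^2 - 12*v + 9 = 0 := hv
  have hv0 : 0 < v := by linarith
  have hv3 : 1 + v ≠ 0 := by positivity
  refine ⟨-2 * v / (3 * (1 + v)), v, 1 / (24 * v), Real.sqrt (1 / (24 * v)), ?_, ?_, ?_, ?_,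
    hv1, hv2⟩
  · rw [Real.sq_sqrt (by positivity)]
  · field_simp
  · field_simp
  · field_simp
    linear_combination hv

theorem cross_bound {g c ε : ℝ} (h : |g - c| ≤ ε) (x y : ℝ) :
    c * (x * y) - ε * (x ^ 2 + y ^ 2) / 2 ≤ g * (x * y) := by
  obtain ⟨h1, h2⟩ := abs_le.mp h
  nlinarith [mul_nonneg (by linarith : 0 ≤ ε + (g - c)) (sq_nonneg (x + y)),
    mul_nonneg (by linarith : 0 ≤ ε - (g - c)) (sq_nonneg (x - y))]

theorem sos_bound (x0 x1 x2 x3 : ℝ) :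
    0.005 * (x0 ^ 2 + x1 ^ 2 + x2 ^ 2 + x3 ^ 2) ≤ ((1089/1000)*(x0*x0) + (-819/250)*(x0*x1) + (493/250)*(x0*x2) + (-479/500)*(x0*x3) + (3553/1000)*(x1*x1) + (-3121/500)*(x1*x2) + (1387/500)*(x1*x3) + (2223/500)*(x2*x2) + (-263/50)*(x2*x3) + (2069/1000)*(x3*x3)) := by
  nlinarith [sq_nonneg ((1)*x0 + (-819/542)*x1 + (493/542)*x2 + (-479/1084)*x3), sq_nonneg ((1)*x1 + (-442024/290747)*x2 + (359453/581494)*x3), sq_nonneg ((1)*x2 + (-689676509/618938956)*x3), sq_nonneg ((1)*x3)]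

/-- The candidate matrix. -/
noncomputable def Gmat (u v k : ℝ) : Matrix (Fin 4) (Fin 4) ℝ :=
    !![(3/8)*v, (3/8)*u + (-1/2)*v, (3/8) + (-1/2)*u + (1/8)*v, (-5/12) + (1/8)*u;
      (3/8)*u + (-1/2)*v, (5/4) + (-1)*u + (2/3)*v + (-9)*k, (-29/12) + (19/24)*u + (-1/6)*v + (12)*k, (97/72) + (-1/6)*u + (-3)*k;
      (3/8) + (-1/2)*u + (1/8)*v, (-29/12) + (19/24)*u + (-1/6)*v + (12)*k, (79/18) + (-1/3)*u + (1/24)*v + (-16)*k, (-8/3) + (1/24)*u + (4)*k;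
      (-5/12) + (1/8)*u, (97/72) + (-1/6)*u + (-3)*k, (-8/3) + (1/24)*u + (4)*k, (25/12) + (-1)*k]

theorem Gmat_symm (u v k : ℝ) : (Gmat u v k).IsSymm := by
  ext i j
  fin_cases i <;> fin_cases j <;> rfl

theorem Gmat_pos (u v k : ℝ) (hv1 : 2.9043 ≤ v) (hv2 : v ≤ 2.9044)
    (hu1 : -0.49595 ≤ u) (hu2 : u ≤ -0.4959) (hk1 : 0.01434 ≤ k) (hk2 : k ≤ 0.01435) :
    (Gmat u v k).PosDef := by
  refine Matrix.PosDef.of_dotProduct_mulVec_pos ?_ ?_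
  · have := Gmat_symm u v k
    rwa [Matrix.IsHermitian, Matrix.conjTranspose_eq_transpose_of_trivial]
  intro x hx
  have hpos : 0 < x 0 ^ 2 + x 1 ^ 2 + x 2 ^ 2 + x 3 ^ 2 := by
    by_contra hcon
    apply hx
    ext i
    have h0 := sq_nonneg (x 0)
    have h1 := sq_nonneg (x 1)
    have h2 := sq_nonneg (x 2)
    have h3 := sq_nonneg (x 3)
    fin_cases i
    · exact pow_eq_zero_iff two_ne_zero |>.mp (by linarith : x 0 ^ 2 = 0)
    · exact pow_eq_zero_iff two_ne_zero |>.mp (by linarith : x 1 ^ 2 = 0)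
    · exact pow_eq_zero_iff two_ne_zero |>.mp (by linarith : x 2 ^ 2 = 0)
    · exact pow_eq_zero_iff two_ne_zero |>.mp (by linarith : x 3 ^ 2 = 0)
  have e00 : |((3/8)*v) - (1089/1000)| ≤ 1/1000 := by
    rw [abs_le]; constructor <;> linarith
  have q00 := cross_bound e00 (x 0) (x 0)
  have e01 : |((3/8)*u + (-1/2)*v) - (-819/500)| ≤ 1/1000 := by
    rw [abs_le]; constructor <;> linarith
  have q01 := cross_bound e01 (x 0) (x 1)
  have e02 : |((3/8) + (-1/2)*u + (1/8)*v) - (493/500)| ≤ 1/1000 := by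
    rw [abs_le]; constructor <;> linarith
  have q02 := cross_bound e02 (x 0) (x 2)
  have e03 : |((-5/12) + (1/8)*u) - (-479/1000)| ≤ 1/1000 := by
    rw [abs_le]; constructor <;> linarith
  have q03 := cross_bound e03 (x 0) (x 3)
  have e11 : |((5/4) + (-1)*u + (2/3)*v + (-9)*k) - (3553/1000)| ≤ 1/1000 := by
    rw [abs_le]; constructor <;> linarith
  have q11 := cross_bound e11 (x 1) (x 1)
  have e12 : |((-29/12) + (19/24)*u + (-1/6)*v + (12)*k) - (-3121/1000)| ≤ 1/1000 := by
    rw [abs_le]; constructor <;> linarith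
  have q12 := cross_bound e12 (x 1) (x 2)
  have e13 : |((97/72) + (-1/6)*u + (-3)*k) - (1387/1000)| ≤ 1/1000 := by
    rw [abs_le]; constructor <;> linarith
  have q13 := cross_bound e13 (x 1) (x 3)
  have e22 : |((79/18) + (-1/3)*u + (1/24)*v + (-16)*k) - (2223/500)| ≤ 1/1000 := by
    rw [abs_le]; constructor <;> linarith
  have q22 := cross_bound e22 (x 2) (x 2)
  have e23 : |((-8/3) + (1/24)*u + (4)*k) - (-263/100)| ≤ 1/1000 := by
    rw [abs_le]; constructor <;> linarith
  have q23 := cross_bound e23 (x 2) (x 3)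
  have e33 : |((25/12) + (-1)*k) - (2069/1000)| ≤ 1/1000 := by
    rw [abs_le]; constructor <;> linarith
  have q33 := cross_bound e33 (x 3) (x 3)
  simp only [Gmat, dotProduct, Matrix.mulVec, Fin.sum_univ_four, Matrix.of_apply, Matrix.cons_val,
    Pi.star_apply, star_trivial]
  have sos := sos_bound (x 0) (x 1) (x 2) (x 3)
  linarith [q00, q01, q02, q03, q11, q12, q13, q22, q23, q33]

/-- Lemma 4.1, Nevanlinna–Odeh multiplier identity, case k = 4. -/
theorem NevanlinnaOdeh_multiplier_BDF4 :
    ∃ (τ : ℝ) (G : Matrix (Fin 4) (Fin 4) ℝ) (a : Fin 5 → ℝ),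
      0 ≤ τ ∧ τ < 1 ∧ G.IsSymm ∧ G.PosDef ∧
      ∀ (H : Type u) [NormedAddCommGroup H] [InnerProductSpace ℝ H],
        ∀ φ0 φ1 φ2 φ3 φ4 : H,
          ⟪(25/12 : ℝ) • φ4 - (4 : ℝ) • φ3 + (3 : ℝ) • φ2 - (4/3 : ℝ) • φ1
              + (1/4 : ℝ) • φ0, φ4 - τ • φ3⟫
            = (∑ i : Fin 4, ∑ j : Fin 4,
                G i j * ⟪![φ0, φ1, φ2, φ3, φ4] i.succ, ![φ0, φ1, φ2, φ3, φ4] j.succ⟫)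
              - (∑ i : Fin 4, ∑ j : Fin 4,
                G i j * ⟪![φ0, φ1, φ2, φ3, φ4] i.castSucc,
                  ![φ0, φ1, φ2, φ3, φ4] j.castSucc⟫)
              + ‖a 0 • φ0 + a 1 • φ1 + a 2 • φ2 + a 3 • φ3 + a 4 • φ4‖ ^ 2 := by
  obtain ⟨u, v, k, K, hK, hkv, h1, h2, hv1, hv2⟩ := exists_params
  have hkv2 : k * v ^ 2 = v / 24 := by linear_combination v * hkv
  have hkuv : k * u * v = u / 24 := by linear_combination u * hkv
  have hku : k * u = -1/36 - u / 24 := by linear_combination k / 3 * h1 - hkuv - 2/3 * hkv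
  have hku2 : k * u ^ 2 = 10/72 - k - v / 24 := by
    linear_combination k / 3 * h2 - hkv2 + 10/3 * hkv
  refine ⟨2/3, Gmat u v k, ![K * (3*v), K * (3*u - 4*v), K * (3 - 4*u + v), K * (u - 4), K],
    by norm_num, by norm_num, Gmat_symm u v k,
    Gmat_pos u v k hv1 hv2 (by nlinarith) (by nlinarith) (by nlinarith) (by nlinarith), ?_⟩
  intro H _ _ φ0 φ1 φ2 φ3 φ4
  rw [← real_inner_self_eq_norm_sq]
  simp only [Gmat, Fin.sum_univ_four, Matrix.of_apply, Matrix.cons_val, show Fin.succ (0 : Fin 4) = 1 from rfl, show Fin.succ (1 : Fin 4) = 2 from rfl, show Fin.succ (2 : Fin 4) = 3 from rfl, show Fin.succ (3 : Fin 4) = 4 from rfl, 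
    show Fin.castSucc (0 : Fin 4) = 0 from rfl, 
    show Fin.castSucc (1 : Fin 4) = 1 from rfl, 
    show Fin.castSucc (2 : Fin 4) = 2 from rfl, 
    show Fin.castSucc (3 : Fin 4) = 3 from rfl,
    inner_add_left, inner_add_right, inner_sub_left, inner_sub_right,
    real_inner_smul_left, real_inner_smul_right]
  simp only [real_inner_comm φ0 φ1, real_inner_comm φ0 φ2, real_inner_comm φ0 φ3, real_inner_comm φ0 φ4, real_inner_comm φ1 φ2, real_inner_comm φ1 φ3, real_inner_comm φ1 φ4, real_inner_comm φ2 φ3, real_inner_comm φ2 φ4, real_inner_comm φ3 φ4]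
  have p00 : K^2 * (3*v) * (3*v) = (3/8)*v := by
    linear_combination (-((3*v) * (3*v))) * hK + (9)*hkv2
  have p01 : K^2 * (3*v) * (3*u - 4*v) = (3/8)*u + (-1/2)*v := by
    linear_combination (-((3*v) * (3*u - 4*v))) * hK + (9)*hkuv + (-12)*hkv2
  have p02 : K^2 * (3*v) * (3 - 4*u + v) = (3/8) + (-1/2)*u + (1/8)*v := by
    linear_combination (-((3*v) * (3 - 4*u + v))) * hK + (9)*hkv + (-12)*hkuv + (3)*hkv2
  have p03 : K^2 * (3*v) * (u - 4) = (-1/2) + (1/8)*u := by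
    linear_combination (-((3*v) * (u - 4))) * hK + (-12)*hkv + (3)*hkuv
  have p04 : K^2 * (3*v) * 1 = (1/8) := by
    linear_combination (-((3*v) * 1)) * hK + (3)*hkv
  have p11 : K^2 * (3*u - 4*v) * (3*u - 4*v) = (5/4) + (-1)*u + (7/24)*v + (-9)*k := by
    linear_combination (-((3*u - 4*v) * (3*u - 4*v))) * hK + (9)*hku2 + (-24)*hkuv + (16)*hkv2
  have p12 : K^2 * (3*u - 4*v) * (3 - 4*u + v) = (-29/12) + (5/12)*u + (1/3)*v + (12)*k := by
    linear_combination (-((3*u - 4*v) * (3 - 4*u + v))) * hK + (9)*hku + (-12)*hkv + (-12)*hku2 + (19)*hkuv + (-4)*hkv2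
  have p13 : K^2 * (3*u - 4*v) * (u - 4) = (17/12) + (1/3)*u + (-1/8)*v + (-3)*k := by
    linear_combination (-((3*u - 4*v) * (u - 4))) * hK + (-12)*hku + (16)*hkv + (3)*hku2 + (-4)*hkuv
  have p14 : K^2 * (3*u - 4*v) * 1 = (-1/4) + (-1/8)*u := by
    linear_combination (-((3*u - 4*v) * 1)) * hK + (3)*hku + (-4)*hkv
  have p22 : K^2 * (3 - 4*u + v) * (3 - 4*u + v) = (113/36) + (2/3)*u + (-5/8)*v + (-7)*k := by
    linear_combination (-((3 - 4*u + v) * (3 - 4*u + v))) * hK + (-24)*hku + (6)*hkv + (16)*hku2 + (-8)*hkuv + (1)*hkv2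
  have p23 : K^2 * (3 - 4*u + v) * (u - 4) = (-5/4) + (-3/4)*u + (1/6)*v + (-8)*k := by
    linear_combination (-((3 - 4*u + v) * (u - 4))) * hK + (19)*hku + (-4)*hkv + (-4)*hku2 + (1)*hkuv
  have p24 : K^2 * (3 - 4*u + v) * 1 = (11/72) + (1/6)*u + (3)*k := by
    linear_combination (-((3 - 4*u + v) * 1)) * hK + (-4)*hku + (1)*hkv
  have p33 : K^2 * (u - 4) * (u - 4) = (13/36) + (1/3)*u + (-1/24)*v + (15)*k := by
    linear_combination (-((u - 4) * (u - 4))) * hK + (-8)*hku + (1)*hku2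
  have p34 : K^2 * (u - 4) * 1 = (-1/36) + (-1/24)*u + (-4)*k := by
    linear_combination (-((u - 4) * 1)) * hK + (1)*hku
  have p44 : K^2 * 1 * 1 = (1)*k := by
    linear_combination (-(1 * 1)) * hK
  linear_combination -1 * inner ℝ φ0 φ0 * p00 - 2 * inner ℝ φ0 φ1 * p01 - 2 * inner ℝ φ0 φ2 * p02 - 2 * inner ℝ φ0 φ3 * p03 - 2 * inner ℝ φ0 φ4 * p04 - 1 * inner ℝ φ1 φ1 * p11 - 2 * inner ℝ φ1 φ2 * p12 - 2 * inner ℝ φ1 φ3 * p13 - 2 * inner ℝ φ1 φ4 * p14 - 1 * inner ℝ φ2 φ2 * p22 - 2 * inner ℝ φ2 φ3 * p23 - 2 * inner ℝ φ2 φ4 * p24 - 1 * inner ℝ φ3 φ3 * p33 - 2 * inner ℝ φ3 φ4 * p34 - 1 * inner ℝ φ4 φ4 * p44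
end

section
/- There exist a real number τ with 0 ≤ τ < 1, a symmetric positive definite real 5×5 matrix G = (g_{ij})_{1≤i,j≤5}, and real numbers a₀, a₁, a₂, a₃, a₄, a₅, such that for every real inner product space H and all φ₀, φ₁, φ₂, φ₃, φ₄, φ₅ ∈ H: ⟪(137/60)·φ₅ − 5·φ₄ + 5·φ₃ − (10/3)·φ₂ + (5/4)·φ₁ − (1/5)·φ₀, φ₅ − τ·φ₄⟫ = Σ_{i,j=1}^{5} g_{ij}·⟪φ_i, φ_j⟫ − Σ_{i,j=1}^{5} g_{ij}·⟪φ_{i−1}, φ_{j−1}⟫ + ‖a₀·φ₀ + a₁·φ₁ + a₂·φ₂ + a₃·φ₃ + a₄·φ₄ + a₅·φ₅‖². (Lemma 4.1, Nevanlinna–Odeh multiplier identity, case k = 5.) -/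
open RealInnerProductSpace

universe u

lemma mul_close {x y x0 y0 ex ey : ℝ} (hx : |x - x0| ≤ ex) (hy : |y - y0| ≤ ey) :
    |x * y - x0 * y0| ≤ ex * (|y0| + ey) + |x0| * ey := by
  have h1 : x * y - x0 * y0 = (x - x0) * y0 + (x - x0) * (y - y0) + x0 * (y - y0) := by ring
  have hex : 0 ≤ ex := (abs_nonneg _).trans hx
  calc |x * y - x0 * y0| ≤ |(x - x0) * y0| + |(x - x0) * (y - y0)| + |x0 * (y - y0)| := by
        rw [h1]; exact abs_add_three _ _ _
    _ = |x - x0| * |y0| + |x - x0| * |y - y0| + |x0| * |y - y0| := by simp only [abs_mul]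
    _ ≤ ex * |y0| + ex * ey + |x0| * ey := by gcongr
    _ = _ := by ring

lemma div_close {x z x0 z0 R0 ex eR e : ℝ} (h8 : 8 ≤ |x|) (hx : |x - x0| ≤ ex)
    (hR : |x * z - R0| ≤ eR) (h : |R0 - x0 * z0| + eR + ex * |z0| ≤ 8 * e) :
    |z - z0| ≤ e := by
  have h1 : x * (z - z0) = (x * z - R0) + (R0 - x0 * z0) + -((x - x0) * z0) := by ring
  have h2 : |x| * |z - z0| ≤ eR + |R0 - x0 * z0| + ex * |z0| := by
    rw [← abs_mul, h1]
    refine (abs_add_three _ _ _).trans ?_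
    rw [abs_neg, abs_mul]
    gcongr
  have h3 : 8 * |z - z0| ≤ |x| * |z - z0| := by gcongr
  linarith

/-- Existence of the spectral factor `(z - 1) b(z) / √71` for `τ = 64 / 71`. -/
lemma exists_factor : ∃ b0 b1 b2 b3 b4 : ℝ,
    b0 * b4 = 71/10 ∧ b0 + b2 + b4 = 16 ∧ b1 + b3 = -8 ∧ b0 * b3 + b4 * b1 = -1463/40 ∧
    b2 * (b0 + b4) + b1 * b3 = 937/12 ∧ |b0 - 8.5485| ≤ 1e-5 ∧
    |b1 - (-4.12195)| ≤ 1e-4 ∧ |b4 - 0.830555| ≤ 1e-4 := by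
  let P : ℝ → ℝ := fun t => ((16*t - t^2 - 71/10) * (t^2 + 71/10) - 937/12 * t^2) *
    (71/10 - t^2)^2 + t^2 * (t * (-1463/40 + 8*t)) * (-8*(71/10 - t^2) - t * (-1463/40 + 8*t))
  have hc : ContinuousOn P (Set.Icc 8.5485 8.54851) := by fun_prop
  have h0 : (0:ℝ) ∈ Set.Icc (P 8.54851) (P 8.5485) := by
    constructor <;> norm_num [P]
  obtain ⟨t, ⟨ht1, ht2⟩, hP⟩ := intermediate_value_Icc' (by norm_num) hc h0
  have ht : t ≠ 0 := by intro h; norm_num [h] at ht1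
  have hk : 71/10 - t^2 < 0 := by nlinarith
  have hk' := hk.ne
  have hb1 : t * (-1463/40 + 8*t) / (71/10 - t^2) * (71/10 - t^2) = t * (-1463/40 + 8*t) :=
    div_mul_cancel₀ _ hk'
  have hb4 : 71/10/t * t = 71/10 := div_mul_cancel₀ _ ht
  refine ⟨t, t * (-1463/40 + 8*t) / (71/10 - t^2), 16 - t - 71/10/t,
    -8 - t * (-1463/40 + 8*t) / (71/10 - t^2), 71/10/t, by linarith, by ring, by ring, ?_, ?_, ?_,
    ?_, ?_⟩
  · generalize 71/10/t = y at *
    generalize t * (-1463/40 + 8*t) / (71/10 - t^2) = x at *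
    apply mul_left_cancel₀ ht
    linear_combination hb1 + x * hb4
  · generalize 71/10/t = y at *
    generalize t * (-1463/40 + 8*t) / (71/10 - t^2) = x at *
    have hP' : ((16*t - t^2 - y*t) * (t^2 + y*t) - 937/12 * t^2) *
      (71/10 - t^2)^2 + t^2 * (x * (71/10 - t^2)) * (-8*(71/10 - t^2) - x * (71/10 - t^2)) = 0 := by
      rw [hb4, hb1]; exact hP
    apply mul_left_cancel₀ (mul_ne_zero (pow_ne_zero 2 ht) (pow_ne_zero 2 hk'))
    linear_combination hP'
  · rw [abs_le]; constructor <;> norm_num at * <;> linarith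
  · rw [abs_le]
    constructor
    · rw [le_sub_iff_add_le, le_div_iff_of_neg hk]; norm_num at *; nlinarith
    · rw [sub_le_iff_le_add, div_le_iff_of_neg hk]; norm_num at *; nlinarith
  · have htp : 0 < t := by norm_num at *; linarith
    rw [abs_le]
    constructor
    · rw [le_sub_iff_add_le, le_div_iff₀ htp]; norm_num at *; linarith
    · rw [sub_le_iff_le_add, div_le_iff₀ htp]; norm_num at *; linarith

/-- Completing the square. -/
lemma exists_beta {a0 a1 a2 a3 a4 : ℝ} (h0 : |a0 - (-8.5485)| ≤ 1e-5)
    (h1 : |a1 - 12.67045| ≤ 12e-5) (h2 : |a2 - (-10.7429)| ≤ 3e-4)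
    (h3 : |a3 - 10.49899| ≤ 3e-4) (h4 : |a4 - (-4.7086)| ≤ 3e-4) :
    ∃ p q r s : ℝ, a0 * p = -32/5 ∧ a0 * q + a1 * p = 40 ∧ a0 * r + a1 * q + a2 * p = -320/3 ∧
      a0 * s + a1 * r + a2 * q + a3 * p = 160 ∧
      0 < a0^2 - 320 - 2 * (p * a4 + q * a3 + r * a2 + s * a1) - (p^2 + q^2 + r^2 + s^2) := by
  have h8 : 8 ≤ |a0| := by
    rw [abs_le] at h0; norm_num at h0
    rw [le_abs]; right; linarith
  have hne : a0 ≠ 0 := by intro h; norm_num [h] at h8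
  obtain ⟨p, hp⟩ : ∃ p, a0 * p = -32/5 := ⟨-32/5/a0, mul_div_cancel₀ _ hne⟩
  obtain ⟨q, hq⟩ : ∃ q, a0 * q = 40 - a1 * p := ⟨_, mul_div_cancel₀ _ hne⟩
  obtain ⟨r, hr⟩ : ∃ r, a0 * r = -320/3 - a1 * q - a2 * p := ⟨_, mul_div_cancel₀ _ hne⟩
  obtain ⟨s, hs⟩ : ∃ s, a0 * s = 160 - a1 * r - a2 * q - a3 * p := ⟨_, mul_div_cancel₀ _ hne⟩
  refine ⟨p, q, r, s, hp, by linarith, by linarith, by linarith, ?_⟩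
  have bp : |p - 0.748669| ≤ 1e-5 := by
    refine div_close (R0 := -6.4) (eR := 0) h8 h0 ?_ ?_
    · rw [hp]; norm_num
    · norm_num [abs_le, abs_of_nonneg, abs_of_nonpos]
  have bq : |q - (-3.569517)| ≤ 1e-4 := by
    have e1 := mul_close h1 bp
    refine div_close (R0 := 40 - 12.67045 * 0.748669) (eR := 3e-4) h8 h0 ?_ ?_
    · rw [hq]; rw [abs_le] at *; norm_num [abs_of_nonneg, abs_of_nonpos] at *
      constructor <;> linarith
    · norm_num [abs_of_nonneg, abs_of_nonpos]
  have br : |r - 6.246287| ≤ 5e-4 := by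
    have e1 := mul_close h1 bq
    have e2 := mul_close h2 bp
    refine div_close (R0 := -320/3 - 12.67045 * (-3.569517) - (-10.7429) * 0.748669)
      (eR := 3e-3) h8 h0 ?_ ?_
    · rw [hr]; rw [abs_le] at *; norm_num [abs_of_nonneg, abs_of_nonpos] at *
      constructor <;> linarith
    · norm_num [abs_of_nonneg, abs_of_nonpos]
  have bs : |s - (-4.053282)| ≤ 2e-3 := by
    have e1 := mul_close h1 br
    have e2 := mul_close h2 bq
    have e3 := mul_close h3 bp
    refine div_close (R0 := 160 - 12.67045 * 6.246287 - (-10.7429) * (-3.569517)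
      - 10.49899 * 0.748669) (eR := 1e-2) h8 h0 ?_ ?_
    · rw [hs]; rw [abs_le] at *; norm_num [abs_of_nonneg, abs_of_nonpos] at *
      constructor <;> linarith
    · norm_num [abs_of_nonneg, abs_of_nonpos]
  have f0 := mul_close h0 h0
  have f1 := mul_close bp h4
  have f2 := mul_close bq h3
  have f3 := mul_close br h2
  have f4 := mul_close bs h1
  have f5 := mul_close bp bp
  have f6 := mul_close bq bq
  have f7 := mul_close br br
  have f8 := mul_close bs bs
  simp only [pow_two]
  rw [abs_le] at *; norm_num [abs_of_nonneg, abs_of_nonpos] at *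
  linarith

/-- The matrix `G` attached to the spectral factor. -/
noncomputable def GM (a0 a1 a2 a3 a4 : ℝ) : Matrix (Fin 5) (Fin 5) ℝ :=
  !![(a0*a0)/71, (a0*a1)/71, (a0*a2)/71, (a0*a3)/71, (a0*a4 + 32*(-1/5))/71;
    (a0*a1)/71, (a1*a1 + a0*a0)/71, (a1*a2 + a0*a1)/71, (a1*a3 + a0*a2)/71, (a1*a4 + a0*a3 + 32*(5/4))/71;
    (a0*a2)/71, (a1*a2 + a0*a1)/71, (a2*a2 + a1*a1 + a0*a0)/71, (a2*a3 + a1*a2 + a0*a1)/71, (a2*a4 + a1*a3 + a0*a2 + 32*(-10/3))/71;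
    (a0*a3)/71, (a1*a3 + a0*a2)/71, (a2*a3 + a1*a2 + a0*a1)/71, (a3*a3 + a2*a2 + a1*a1 + a0*a0)/71, (a3*a4 + a2*a3 + a1*a2 + a0*a1 + 32*5)/71;
    (a0*a4 + 32*(-1/5))/71, (a1*a4 + a0*a3 + 32*(5/4))/71, (a2*a4 + a1*a3 + a0*a2 + 32*(-10/3))/71, (a3*a4 + a2*a3 + a1*a2 + a0*a1 + 32*5)/71, (a4*a4 + a3*a3 + a2*a2 + a1*a1 + a0*a0 - 320)/71]

lemma GM_isSymm (a0 a1 a2 a3 a4 : ℝ) : (GM a0 a1 a2 a3 a4).IsSymm := by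
  ext i j
  fin_cases i <;> fin_cases j <;> simp [GM]

lemma squares_zero {A B C D d e : ℝ} (hd : 0 < d)
    (h : ¬ 0 < A^2 + B^2 + C^2 + D^2 + d * e^2) : A = 0 ∧ B = 0 ∧ C = 0 ∧ D = 0 ∧ e = 0 := by
  refine ⟨?_, ?_, ?_, ?_, ?_⟩ <;> by_contra hz <;> exact h (by positivity)

lemma GM_posDef {a0 a1 a2 a3 a4 p q r s : ℝ} (hne : a0 ≠ 0) (hp : a0 * p = -32/5)
    (hq : a0 * q + a1 * p = 40) (hr : a0 * r + a1 * q + a2 * p = -320/3)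
    (hs : a0 * s + a1 * r + a2 * q + a3 * p = 160)
    (hd : 0 < a0^2 - 320 - 2 * (p * a4 + q * a3 + r * a2 + s * a1) - (p^2 + q^2 + r^2 + s^2)) :
    (GM a0 a1 a2 a3 a4).PosDef := by
  refine Matrix.PosDef.of_dotProduct_mulVec_pos ?_ ?_
  · have h := GM_isSymm a0 a1 a2 a3 a4
    rwa [Matrix.IsHermitian, Matrix.conjTranspose_eq_transpose_of_trivial]
  · intro x hx
    set d := a0^2 - 320 - 2 * (p * a4 + q * a3 + r * a2 + s * a1) - (p^2 + q^2 + r^2 + s^2) with hdd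
    have key : star x ⬝ᵥ (GM a0 a1 a2 a3 a4).mulVec x =
        ((a0 * x 0 + a1 * x 1 + a2 * x 2 + a3 * x 3 + a4 * x 4 + p * x 4)^2
        + (a0 * x 1 + a1 * x 2 + a2 * x 3 + a3 * x 4 + q * x 4)^2
        + (a0 * x 2 + a1 * x 3 + a2 * x 4 + r * x 4)^2
        + (a0 * x 3 + a1 * x 4 + s * x 4)^2 + d * (x 4)^2) / 71 := by
      simp only [dotProduct, Matrix.mulVec, GM, Fin.sum_univ_five, hdd, star_trivial,
        Matrix.of_apply, Matrix.cons_val]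
      linear_combination (-2/71 * x 4) * (x 0 * hp + x 1 * hq + x 2 * hr + x 3 * hs)
    rw [key]
    refine div_pos ?_ (by norm_num)
    by_contra hcon
    apply hx
    obtain ⟨y0, y1, y2, y3, z4⟩ := squares_zero hd hcon
    have z3 : x 3 = 0 := by simpa [z4, hne] using y3
    have z2 : x 2 = 0 := by simpa [z4, z3, hne] using y2
    have z1 : x 1 = 0 := by simpa [z4, z3, z2, hne] using y1
    have z0 : x 0 = 0 := by simpa [z4, z3, z2, z1, hne] using y0
    ext i
    fin_cases i <;> simp [z0, z1, z2, z3, z4]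

/-- Lemma 4.1, Nevanlinna–Odeh multiplier identity, case k = 5. -/
theorem NevanlinnaOdeh_multiplier_BDF5 :
    ∃ (τ : ℝ) (G : Matrix (Fin 5) (Fin 5) ℝ) (a : Fin 6 → ℝ),
      0 ≤ τ ∧ τ < 1 ∧ G.IsSymm ∧ G.PosDef ∧
      ∀ (H : Type u) [NormedAddCommGroup H] [InnerProductSpace ℝ H],
        ∀ φ0 φ1 φ2 φ3 φ4 φ5 : H,
          ⟪(137/60 : ℝ) • φ5 - (5 : ℝ) • φ4 + (5 : ℝ) • φ3 - (10/3 : ℝ) • φ2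
              + (5/4 : ℝ) • φ1 - (1/5 : ℝ) • φ0, φ5 - τ • φ4⟫
            = (∑ i : Fin 5, ∑ j : Fin 5,
                G i j * ⟪![φ0, φ1, φ2, φ3, φ4, φ5] i.succ,
                  ![φ0, φ1, φ2, φ3, φ4, φ5] j.succ⟫)
              - (∑ i : Fin 5, ∑ j : Fin 5,
                G i j * ⟪![φ0, φ1, φ2, φ3, φ4, φ5] i.castSucc,
                  ![φ0, φ1, φ2, φ3, φ4, φ5] j.castSucc⟫)
              + ‖a 0 • φ0 + a 1 • φ1 + a 2 • φ2 + a 3 • φ3 + a 4 • φ4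
                  + a 5 • φ5‖ ^ 2 := by
  obtain ⟨b0, b1, b2, b3, b4, g4, gS, gD, g3, g2, k0, k1, k4⟩ := exists_factor
  have e2 : b2 = 16 - b0 - b4 := by linarith
  have e3 : b3 = -8 - b1 := by linarith
  obtain ⟨a0, ha0⟩ : ∃ a0, a0 = -b0 := ⟨_, rfl⟩
  obtain ⟨a1, ha1⟩ : ∃ a1, a1 = (b0 - b1) := ⟨_, rfl⟩
  obtain ⟨a2, ha2⟩ : ∃ a2, a2 = (b1 - b2) := ⟨_, rfl⟩
  obtain ⟨a3, ha3⟩ : ∃ a3, a3 = (b2 - b3) := ⟨_, rfl⟩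
  obtain ⟨a4, ha4⟩ : ∃ a4, a4 = (b3 - b4) := ⟨_, rfl⟩
  obtain ⟨a5, ha5⟩ : ∃ a5, a5 = b4 := ⟨_, rfl⟩
  have g1 : b0 * b1 + b1 * b2 + b2 * b3 + b3 * b4 = -8 * 16 + 1463/40 := by
    linear_combination b2 * gD + (b1 + b3) * gS + gD * (16 - b2) - g3
  have g0 : b0^2 + b1^2 + b2^2 + b3^2 + b4^2 = 320 - 2 * (71/10 + 937/12) := by
    linear_combination (b0 + b2 + b4 + 16) * gS + (b1 + b3 - 8) * gD - 2 * g4 - 2 * g2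
  have R0 : a0*a0 + a1*a1 + a2*a2 + a3*a3 + a4*a4 + a5*a5 = 28927/60 := by
    simp only [ha0, ha1, ha2, ha3, ha4, ha5]; linear_combination 2 * g0 - 2 * g1
  have R1 : a0*a1 + a1*a2 + a2*a3 + a3*a4 + a4*a5 = -12317/30 := by
    simp only [ha0, ha1, ha2, ha3, ha4, ha5]; linear_combination 2 * g1 - g0 - g2
  have R2 : a0*a2 + a1*a3 + a2*a4 + a3*a5 = 1705/6 := by
    simp only [ha0, ha1, ha2, ha3, ha4, ha5]; linear_combination 2 * g2 - g1 - g3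
  have R3 : a0*a3 + a1*a4 + a2*a5 = -475/3 := by
    simp only [ha0, ha1, ha2, ha3, ha4, ha5]; linear_combination 2 * g3 - g2 - g4
  have R4 : a0*a4 + a1*a5 = 2031/40 := by
    simp only [ha0, ha1, ha2, ha3, ha4, ha5]; linear_combination 2 * g4 - g3
  have R5 : a0*a5 = -71/10 := by
    simp only [ha0, ha1, ha2, ha3, ha4, ha5]; linear_combination - g4
  obtain ⟨p, q, r, s, hp, hq, hr, hs, hd⟩ :
    ∃ p q r s : ℝ, a0 * p = -32/5 ∧ a0 * q + a1 * p = 40 ∧ a0 * r + a1 * q + a2 * p = -320/3 ∧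
      a0 * s + a1 * r + a2 * q + a3 * p = 160 ∧
      0 < a0^2 - 320 - 2 * (p * a4 + q * a3 + r * a2 + s * a1) - (p^2 + q^2 + r^2 + s^2) := by
    rw [abs_le] at k0 k1 k4
    norm_num at k0 k1 k4
    apply exists_beta <;> rw [abs_le] <;> constructor <;> norm_num <;> linarith
  have hne : a0 ≠ 0 := by intro h; norm_num [h] at hp
  refine ⟨64/71, GM a0 a1 a2 a3 a4, fun i => (√71)⁻¹ * ![a0, a1, a2, a3, a4, a5] i, by norm_num,
    by norm_num, GM_isSymm _ _ _ _ _, GM_posDef hne hp hq hr hs hd, ?_⟩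
  intro H _ _ φ0 φ1 φ2 φ3 φ4 φ5
  have hn : ‖((√71)⁻¹ * a0) • φ0 + ((√71)⁻¹ * a1) • φ1 + ((√71)⁻¹ * a2) • φ2
      + ((√71)⁻¹ * a3) • φ3 + ((√71)⁻¹ * a4) • φ4 + ((√71)⁻¹ * a5) • φ5‖ ^ 2
      = ⟪a0 • φ0 + a1 • φ1 + a2 • φ2 + a3 • φ3 + a4 • φ4 + a5 • φ5,
        a0 • φ0 + a1 • φ1 + a2 • φ2 + a3 • φ3 + a4 • φ4 + a5 • φ5⟫ / 71 := by
    simp only [mul_smul, ← smul_add]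
    rw [norm_smul, mul_pow, real_inner_self_eq_norm_sq, norm_inv, inv_pow, Real.norm_eq_abs,
      sq_abs, Real.sq_sqrt (by norm_num)]
    ring
  simp only [Matrix.cons_val]
  rw [hn]
  simp only [Fin.sum_univ_five, GM, Matrix.of_apply, Matrix.cons_val, Fin.reduceSucc,
    Fin.reduceCastSucc, Fin.isValue, Fin.succ_zero_eq_one, Fin.succ_one_eq_two, Fin.castSucc_zero, Fin.castSucc_one]
  simp only [inner_add_left, inner_sub_left, inner_add_right, inner_sub_right, real_inner_smul_left,
    real_inner_smul_right]
  simp only [real_inner_comm φ0 φ1, real_inner_comm φ0 φ2, real_inner_comm φ0 φ3, real_inner_comm φ0 φ4,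
    real_inner_comm φ0 φ5, real_inner_comm φ1 φ2, real_inner_comm φ1 φ3, real_inner_comm φ1 φ4,
    real_inner_comm φ1 φ5, real_inner_comm φ2 φ3, real_inner_comm φ2 φ4, real_inner_comm φ2 φ5,
    real_inner_comm φ3 φ4, real_inner_comm φ3 φ5, real_inner_comm φ4 φ5]
  linear_combination (-1/71) * (R0 * ⟪φ5, φ5⟫ + 2 * R1 * ⟪φ4, φ5⟫ + 2 * R2 * ⟪φ3, φ5⟫
    + 2 * R3 * ⟪φ2, φ5⟫ + 2 * R4 * ⟪φ1, φ5⟫ + 2 * R5 * ⟪φ0, φ5⟫)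
end

section
/- Let δt > 0 and let R1n, R2n be real numbers with Rn := R1n + R2n ≥ 0. Let E1b, E2b > 0 and D1, D2 be real numbers with D := D1 + D2 ≥ 0. Suppose Rt1, Rt2 ∈ ℝ satisfy Rt1 − R1n = −δt·(Rt1 + Rt2)·D1/(E1b + E2b) and Rt2 − R2n = −δt·(Rt1 + Rt2)·D2/(E1b + E2b). Then Rt := Rt1 + Rt2 = Rn/(1 + δt·D/(E1b + E2b)) ≥ 0. Moreover, for any real Eφ > 0, K ≥ 0, γ ≥ 0 and ζ₀ ∈ [0,1], if Rnew := ζ₀·Rt + (1 − ζ₀)·Eφ satisfies (Rnew − Rt)/δt ≤ −γ·K + Rt·D/(E1b + E2b), then Rnew ≥ 0 and Rnew − Rn ≤ −δt·γ·K ≤ 0. (Per-step unconditional energy stability of the relaxed multiple-SAV (R-MGSAV) scheme, Theorem 5.1.) -/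
/-- Per-step unconditional energy stability of the relaxed multiple-SAV
(R-MGSAV) scheme, Theorem 5.1. -/
theorem RMGSAV_per_step_energy_stability
    (δt R1n R2n E1b E2b D1 D2 : ℝ)
    (hδt : 0 < δt) (hRn : 0 ≤ R1n + R2n)
    (hE1b : 0 < E1b) (hE2b : 0 < E2b) (hD : 0 ≤ D1 + D2)
    (Rt1 Rt2 : ℝ)
    (hRt1 : Rt1 - R1n = -(δt * (Rt1 + Rt2) * D1 / (E1b + E2b)))
    (hRt2 : Rt2 - R2n = -(δt * (Rt1 + Rt2) * D2 / (E1b + E2b))) :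
    (Rt1 + Rt2 = (R1n + R2n) / (1 + δt * (D1 + D2) / (E1b + E2b)) ∧
      0 ≤ Rt1 + Rt2) ∧
    ∀ Eφ K γ ζ₀ : ℝ, 0 < Eφ → 0 ≤ K → 0 ≤ γ → 0 ≤ ζ₀ → ζ₀ ≤ 1 →
      ((ζ₀ * (Rt1 + Rt2) + (1 - ζ₀) * Eφ) - (Rt1 + Rt2)) / δt
          ≤ -(γ * K) + (Rt1 + Rt2) * (D1 + D2) / (E1b + E2b) →
      0 ≤ ζ₀ * (Rt1 + Rt2) + (1 - ζ₀) * Eφ ∧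
      (ζ₀ * (Rt1 + Rt2) + (1 - ζ₀) * Eφ) - (R1n + R2n) ≤ -(δt * γ * K) ∧
      -(δt * γ * K) ≤ 0 := by
  have hE : 0 < E1b + E2b := by linarith
  have hsum : (Rt1 + Rt2) - (R1n + R2n)
      = -(δt * ((Rt1 + Rt2) * (D1 + D2) / (E1b + E2b))) := by
    have h : (Rt1 + Rt2) - (R1n + R2n) = (Rt1 - R1n) + (Rt2 - R2n) := by ring
    rw [h, hRt1, hRt2]
    ring
  have hpos : 0 < 1 + δt * (D1 + D2) / (E1b + E2b) := by positivity
  have hRt : Rt1 + Rt2 = (R1n + R2n) / (1 + δt * (D1 + D2) / (E1b + E2b)) := by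
    rw [eq_div_iff hpos.ne']
    have h : (Rt1 + Rt2) * (1 + δt * (D1 + D2) / (E1b + E2b))
        = (Rt1 + Rt2) + δt * ((Rt1 + Rt2) * (D1 + D2) / (E1b + E2b)) := by ring
    rw [h]
    linarith
  have hnn : 0 ≤ Rt1 + Rt2 := by
    rw [hRt]
    exact div_nonneg hRn hpos.le
  refine ⟨⟨hRt, hnn⟩, ?_⟩
  intro Eφ K γ ζ₀ hEφ hK hγ h0 h1 hV
  refine ⟨?_, ?_, ?_⟩
  · exact add_nonneg (mul_nonneg h0 hnn) (mul_nonneg (by linarith) hEφ.le)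
  · rw [div_le_iff₀ hδt] at hV
    linarith
  · have : 0 ≤ δt * γ * K := by positivity
    linarith
end

section
/- Suppose vectors φ0, φ1, μ, b in H and real numbers r0, r1 satisfy: (i) φ1 − φ0 = −δt·(G μ); (ii) μ = L φ1 + r1·b; (iii) r1 − r0 = (1/2)·⟪b, φ1 − φ0⟫. Then (1/2)·⟪L φ1, φ1⟫ + r1² − ((1/2)·⟪L φ0, φ0⟫ + r0²) ≤ −δt·⟪G μ, μ⟫; that is, the first-order SAV scheme is unconditionally energy stable with the modified energy Ẽ(φⁿ) = (1/2)(𝓛φⁿ, φⁿ) + (rⁿ)². -/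
open RealInnerProductSpace

/-- Unconditional energy stability of the original first-order SAV scheme with
the modified energy Ẽ(φⁿ) = (1/2)(𝓛φⁿ, φⁿ) + (rⁿ)². -/
theorem SAV_BDF1_energy_stable
    {H : Type*} [NormedAddCommGroup H] [InnerProductSpace ℝ H]
    (L G : H →L[ℝ] H)
    (hLsym : ∀ x y : H, ⟪L x, y⟫ = ⟪x, L y⟫)
    (hLpos : ∀ x : H, 0 ≤ ⟪L x, x⟫)
    (hGpos : ∀ x : H, 0 ≤ ⟪G x, x⟫)
    (δt : ℝ) (hδt : 0 < δt)
    (φ0 φ1 μ b : H) (r0 r1 : ℝ)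
    (h1 : φ1 - φ0 = -(δt • G μ))
    (h2 : μ = L φ1 + r1 • b)
    (h3 : r1 - r0 = (1/2) * ⟪b, φ1 - φ0⟫) :
    (1/2) * ⟪L φ1, φ1⟫ + r1 ^ 2 - ((1/2) * ⟪L φ0, φ0⟫ + r0 ^ 2)
      ≤ -(δt * ⟪G μ, μ⟫) := by
  have e1 : ⟪φ1 - φ0, μ⟫ = -(δt * ⟪G μ, μ⟫) := by
    rw [h1, inner_neg_left, real_inner_smul_left]
  have e2 : ⟪φ1 - φ0, μ⟫ = ⟪L φ1, φ1 - φ0⟫ + r1 * ⟪b, φ1 - φ0⟫ := by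
    rw [real_inner_comm, h2, inner_add_left, real_inner_smul_left]
  have e3 := hLpos (φ1 - φ0)
  have e4 : ⟪L φ0, φ1⟫ = ⟪L φ1, φ0⟫ := by
    rw [hLsym, real_inner_comm]
  rw [map_sub, inner_sub_left, inner_sub_right, inner_sub_right, e4] at e3
  rw [inner_sub_right (L φ1)] at e2
  have e5 : ⟪b, φ1 - φ0⟫ = 2 * (r1 - r0) := by linarith
  rw [e5] at e2
  rw [← e1, e2]
  nlinarith [sq_nonneg (r1 - r0)]
end
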